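/- Let n ≥ 1, m ∈ ℝ, 0 ≤ δ ≤ 1, 0 < ρ ≤ 1 and N₁, N₂ ∈ ℕ. (i) If a : 𝕋ⁿ × ℝⁿ → ℂ is a smooth symbol satisfying |∂_x^β ∂_ξ^α a(x,ξ)| ≤ C_{α,β} ⟨ξ⟩^{m − ρ|α| + δ|β|} for all (x,ξ) and all multi-indices with |α| ≤ N₁, |β| ≤ N₂, then its restriction ã = a|_{𝕋ⁿ×ℤⁿ} satisfies |∂_x^β Δ_ξ^α ã(x,ξ)| ≤ C′_{α,β} ⟨ξ⟩^{m − ρ|α| + δ|β|} for all (x,ξ) ∈ 𝕋ⁿ × ℤⁿ and all |α| ≤ N₁, |β| ≤ N₂. (ii) Conversely, every symbol ã : 𝕋ⁿ × ℤⁿ → ℂ, smooth in x, satisfying |∂_x^β Δ_ξ^α ã(x,ξ)| ≤ C_{α,β} ⟨ξ⟩^{m − ρ|α| + δ|β|} for all |α| ≤ N₁, |β| ≤ N₂, is the restriction to 𝕋ⁿ × ℤⁿ of a smooth symbol a : 𝕋ⁿ × ℝⁿ → ℂ satisfying |∂_x^β ∂_ξ^α a(x,ξ)| ≤ C′_{α,β}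 ⟨ξ⟩^{m − ρ|α| + δ|β|} for all |α| ≤ N₁, |β| ≤ N₂. -/

import Mathlib

open MeasureTheory Real ENNReal

noncomputable section

/-- Partial derivative of a complex-valued function on `ℝⁿ` in the `j`-th coordinate
direction. -/
def pd {n : ℕ} (j : Fin n) (f : (Fin n → ℝ) → ℂ) : (Fin n → ℝ) → ℂ :=
  fun x => fderiv ℝ f x (Pi.single j 1)

/-- The canonical list of directions associated to a multi-index `β ∈ ℕⁿ`. -/
def mIdxList {n : ℕ} (β : Fin n → ℕ) : List (Fin n) :=
  (List.finRange n).flatMap fun j => List.replicate (β j) j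

/-- Iterated partial derivative `∂^β` associated to a multi-index `β`. -/
def pdM {n : ℕ} (β : Fin n → ℕ) (f : (Fin n → ℝ) → ℂ) : (Fin n → ℝ) → ℂ :=
  (mIdxList β).foldr pd f

/-- Forward difference operator in the `j`-th direction on functions of `ξ ∈ ℤⁿ`. -/
def dd {n : ℕ} (j : Fin n) (g : (Fin n → ℤ) → ℂ) : (Fin n → ℤ) → ℂ :=
  fun ξ => g (ξ + Pi.single j 1) - g ξ

/-- Iterated difference operator `Δ_ξ^α` associated to a multi-index `α`. -/
def ddM {n : ℕ} (α : Fin n → ℕ) (g : (Fin n → ℤ) → ℂ) : (Fin n → ℤ) → ℂ :=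
  (mIdxList α).foldr dd g

/-- Japanese bracket `⟨ξ⟩ = (1+|ξ|²)^{1/2}` of a lattice point `ξ ∈ ℤⁿ`. -/
def jb {n : ℕ} (ξ : Fin n → ℤ) : ℝ := Real.sqrt (1 + ∑ j, ((ξ j : ℝ)) ^ 2)

/-- Japanese bracket `⟨ξ⟩ = (1+|ξ|²)^{1/2}` of a vector `ξ ∈ ℝⁿ`. -/
def jbR {n : ℕ} (ξ : Fin n → ℝ) : ℝ := Real.sqrt (1 + ∑ j, (ξ j) ^ 2)

/-- The canonical embedding `ℤⁿ → ℝⁿ`. -/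
def castZ {n : ℕ} (ξ : Fin n → ℤ) : Fin n → ℝ := fun j => (ξ j : ℝ)

/-- The fundamental domain `[0,1)ⁿ` of the torus `𝕋ⁿ = ℝⁿ/ℤⁿ`. -/
def cube (n : ℕ) : Set (Fin n → ℝ) := Set.univ.pi fun _ => Set.Ico (0 : ℝ) 1

/-- The normalized Lebesgue measure of the torus `𝕋ⁿ`, realized as the Lebesgue measure
on `ℝⁿ` restricted to the fundamental domain `[0,1)ⁿ`. -/
def μT (n : ℕ) : Measure (Fin n → ℝ) := volume.restrict (cube n)

/-- `1`-periodicity of a function on `ℝⁿ` (i.e. the function descends to `𝕋ⁿ`). -/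
def Per {n : ℕ} (f : (Fin n → ℝ) → ℂ) : Prop :=
  ∀ (x : Fin n → ℝ) (v : Fin n → ℤ), f (x + fun j => (v j : ℝ)) = f x

/-- The character `e^{2πi⟨x,ξ⟩}`. -/
def eChar {n : ℕ} (x : Fin n → ℝ) (ξ : Fin n → ℤ) : ℂ :=
  Complex.exp (2 * (π : ℂ) * Complex.I * ∑ j, (x j : ℂ) * (ξ j : ℂ))

/-- Fourier coefficient `f̂(ξ) = ∫_{𝕋ⁿ} e^{-2πi⟨x,ξ⟩} f(x) dx` of a function on `𝕋ⁿ`. -/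
def fc {n : ℕ} (f : (Fin n → ℝ) → ℂ) (ξ : Fin n → ℤ) : ℂ :=
  ∫ x, Complex.exp (-(2 * (π : ℂ) * Complex.I) * ∑ j, (x j : ℂ) * (ξ j : ℂ)) * f x ∂(μT n)

/-- Periodic pseudo-differential operator
    `σ(x,D)f(x) = Σ_{ξ ∈ ℤⁿ} e^{2πi⟨x,ξ⟩} σ(x,ξ) f̂(ξ)`
with symbol `σ` on `𝕋ⁿ × ℤⁿ`. -/
def Op {n : ℕ} (σ : (Fin n → ℝ) → (Fin n → ℤ) → ℂ) (f : (Fin n → ℝ) → ℂ) :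
    (Fin n → ℝ) → ℂ :=
  fun x => ∑' ξ : Fin n → ℤ, eChar x ξ * σ x ξ * fc f ξ

/-- The `L^p(𝕋ⁿ)` norm, for a real exponent `p`. -/
def lpT (n : ℕ) (p : ℝ) (g : (Fin n → ℝ) → ℂ) : ℝ :=
  (∫ x, ‖g x‖ ^ p ∂(μT n)) ^ (1 / p)

/-- `∂_x^β Δ_ξ^α σ(x,ξ)` for a symbol `σ` on `𝕋ⁿ × ℤⁿ` (difference operator applied first,
then the derivatives in `x`). -/
def symbDxD {n : ℕ} (β α : Fin n → ℕ) (σ : (Fin n → ℝ) → (Fin n → ℤ) → ℂ)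
    (x : Fin n → ℝ) (ξ : Fin n → ℤ) : ℂ :=
  pdM β (fun x' => ddM α (σ x') ξ) x

/-- `Δ_ξ^α ∂_x^β σ(x,ξ)` for a symbol `σ` on `𝕋ⁿ × ℤⁿ` (derivatives in `x` applied first,
then the difference operator in `ξ`). -/
def symbDDx {n : ℕ} (α β : Fin n → ℕ) (σ : (Fin n → ℝ) → (Fin n → ℤ) → ℂ)
    (x : Fin n → ℝ) (ξ : Fin n → ℤ) : ℂ :=
  ddM α (fun ξ' => pdM β (fun x' => σ x' ξ') x) ξ

/-- `∂_ξ^α ∂_x^β σ(x,ξ)` for a symbol `σ` on `𝕋ⁿ × ℝⁿ` (derivatives in `x` applied first,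
then the derivatives in `ξ`). -/
def symbDξDx {n : ℕ} (α β : Fin n → ℕ) (σ : (Fin n → ℝ) → (Fin n → ℝ) → ℂ)
    (x ξ : Fin n → ℝ) : ℂ :=
  pdM α (fun ξ' => pdM β (fun x' => σ x' ξ') x) ξ

/-- `∂_x^β ∂_ξ^α σ(x,ξ)` for a symbol `σ` on `𝕋ⁿ × ℝⁿ` (derivatives in `ξ` applied first,
then the derivatives in `x`). -/
def symbDxDξ {n : ℕ} (β α : Fin n → ℕ) (σ : (Fin n → ℝ) → (Fin n → ℝ) → ℂ)
    (x ξ : Fin n → ℝ) : ℂ :=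
  pdM β (fun x' => pdM α (σ x') ξ) x

/-- The Euclidean Fourier transform `û(ξ) = ∫_{ℝⁿ} e^{-2πi⟨x,ξ⟩} u(x) dx`. -/
def FT {n : ℕ} (u : (Fin n → ℝ) → ℂ) (ξ : Fin n → ℝ) : ℂ :=
  ∫ x, Complex.exp (-(2 * (π : ℂ) * Complex.I) * ∑ j, (x j : ℂ) * (ξ j : ℂ)) * u x

/-- Pseudo-differential operator on `ℝⁿ`:
`T_σ u(x) = ∫_{ℝⁿ} e^{2πi⟨x,ξ⟩} σ(x,ξ) û(ξ) dξ`. -/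
def OpR {n : ℕ} (σ : (Fin n → ℝ) → (Fin n → ℝ) → ℂ) (u : (Fin n → ℝ) → ℂ) :
    (Fin n → ℝ) → ℂ :=
  fun x => ∫ ξ, Complex.exp (2 * (π : ℂ) * Complex.I * ∑ j, (x j : ℂ) * (ξ j : ℂ)) * σ x ξ * FT u ξ

/-- Periodic amplitude operator
`a(x,y,D)u(x) = ∫_{𝕋ⁿ} ∫_{ℝⁿ} e^{2πi⟨x-y,ξ⟩} a(x,y,ξ) u(y) dξ dy`. -/
def OpAmp {n : ℕ} (a : (Fin n → ℝ) → (Fin n → ℝ) → (Fin n → ℝ) → ℂ)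
    (u : (Fin n → ℝ) → ℂ) : (Fin n → ℝ) → ℂ :=
  fun x => ∫ y,
    (∫ ξ, Complex.exp (2 * (π : ℂ) * Complex.I * ∑ j, ((x j : ℂ) - (y j : ℂ)) * (ξ j : ℂ)) *
        a x y ξ) * u y ∂(μT n)

/-- The `L^p(ℝⁿ)` norm, for a real exponent `p`. -/
def lpR (n : ℕ) (p : ℝ) (g : (Fin n → ℝ) → ℂ) : ℝ :=
  (∫ x, ‖g x‖ ^ p) ^ (1 / p)


/-- The space of smooth compactly supported real functions on the line. -/
def testFun : Submodule ℝ (ℝ → ℝ) where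
  carrier := {f | ContDiff ℝ (⊤ : ℕ∞) f ∧ ∃ R : ℝ, ∀ x, R ≤ |x| → f x = 0}
  zero_mem' := ⟨contDiff_const, 0, fun _ _ => rfl⟩
  add_mem' := by
    rintro f g ⟨hf, R, hR⟩ ⟨hg, R', hR'⟩
    refine ⟨hf.add hg, max R R', fun x hx => ?_⟩
    simp [hR x ((le_max_left _ _).trans hx), hR' x ((le_max_right _ _).trans hx)]
  smul_mem' := by
    rintro c f ⟨hf, R, hR⟩
    exact ⟨contDiff_const.smul hf, R, fun x hx => by simp [hR x hx]⟩

lemma testFun_continuous (f : testFun) : Continuous (f : ℝ → ℝ) := f.2.1.continuous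

/-- Unit translation on test functions. -/
def shiftOp : Module.End ℝ testFun where
  toFun f := ⟨fun x => (f : ℝ → ℝ) (x + 1), by
    obtain ⟨hf, R, hR⟩ := f.2
    refine ⟨hf.comp (contDiff_id.add contDiff_const), R + 1, fun x hx => hR _ ?_⟩
    have := abs_sub_abs_le_abs_sub x (-1)
    simp at this
    linarith⟩
  map_add' _ _ := rfl
  map_smul' _ _ := rfl

/-- Differentiation on test functions. -/
def derivOp : Module.End ℝ testFun where
  toFun f := ⟨deriv (f : ℝ → ℝ), by
    obtain ⟨hf, R, hR⟩ := f.2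
    refine ⟨(contDiff_infty_iff_deriv.1 hf).2, R + 1, fun x hx => ?_⟩
    have : (f : ℝ → ℝ) =ᶠ[nhds x] fun _ => 0 := by
      filter_upwards [continuous_abs.continuousAt.eventually (lt_mem_nhds (show R < |x| by linarith))]
        with y hy using hR y hy.le
    simp [this.deriv_eq]⟩
  map_add' f g := by
    ext x
    exact deriv_add (f.2.1.differentiable (by simp) x) (g.2.1.differentiable (by simp) x)
  map_smul' c f := by
    ext x
    exact deriv_const_smul c (f.2.1.differentiable (by simp) x)

lemma hasDerivAt_unit_integral {f : ℝ → ℝ} (hf : Continuous f) (x : ℝ) :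
    HasDerivAt (fun x => ∫ t in x..x + 1, f t) (f (x + 1) - f x) x := by
  have hI : ∀ a b, IntervalIntegrable f volume a b := fun a b => hf.intervalIntegrable a b
  have h1 : ∀ y, HasDerivAt (fun x => ∫ t in (0 : ℝ)..x, f t) (f y) y := fun y =>
    intervalIntegral.integral_hasDerivAt_right (hI _ _)
      (hf.stronglyMeasurableAtFilter _ _) hf.continuousAt
  have h2 : (fun x => ∫ t in x..x + 1, f t) =
      fun x => (∫ t in (0 : ℝ)..(x + 1), f t) - ∫ t in (0 : ℝ)..x, f t := by
    funext x
    rw [intervalIntegral.integral_interval_sub_left (hI _ _) (hI _ _)]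
  rw [h2]
  exact ((h1 (x + 1)).comp_add_const x 1).sub (h1 x)

/-- Averaging over the unit interval to the right, on test functions. -/
def avgOp : Module.End ℝ testFun where
  toFun f := ⟨fun x => ∫ t in x..x + 1, (f : ℝ → ℝ) t, by
    obtain ⟨hf, R, hR⟩ := f.2
    refine ⟨contDiff_infty_iff_deriv.2 ⟨fun x =>
      (hasDerivAt_unit_integral hf.continuous x).differentiableAt, ?_⟩, R + 1, fun x hx => ?_⟩
    · have : deriv (fun x => ∫ t in x..x + 1, (f : ℝ → ℝ) t) =
          fun x => (f : ℝ → ℝ) (x + 1) - (f : ℝ → ℝ) x :=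
        funext fun x => (hasDerivAt_unit_integral hf.continuous x).deriv
      rw [this]
      exact (hf.comp (contDiff_id.add contDiff_const)).sub hf
    · beta_reduce
      rw [intervalIntegral.integral_congr (g := fun _ => (0 : ℝ))]
      · simp
      · intro t ht
        rw [Set.uIcc_of_le (by linarith)] at ht
        refine hR t ?_
        have h1 := abs_sub_abs_le_abs_sub x t
        have h2 : |x - t| ≤ 1 := abs_le.2 ⟨by linarith [ht.2], by linarith [ht.1]⟩
        linarith⟩
  map_add' f g := by
    ext x
    exact intervalIntegral.integral_add ((testFun_continuous f).intervalIntegrable _ _)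
      ((testFun_continuous g).intervalIntegrable _ _)
  map_smul' c f := by
    ext x
    exact intervalIntegral.integral_smul c (f : ℝ → ℝ)

lemma derivOp_mul_avgOp : derivOp * avgOp = shiftOp - 1 := by
  ext f x
  exact (hasDerivAt_unit_integral (testFun_continuous f) x).deriv

lemma avgOp_mul_derivOp : avgOp * derivOp = shiftOp - 1 := by
  ext f x
  exact intervalIntegral.integral_deriv_eq_sub
    (fun y _ => f.2.1.differentiable (by simp) y)
    ((testFun_continuous (derivOp f)).intervalIntegrable _ _)

lemma commute_avgOp_shiftOp : Commute avgOp shiftOp := by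
  ext f x
  exact intervalIntegral.integral_comp_add_right (f : ℝ → ℝ) 1

/-- The polynomial `G` is the generating function of the values of `f` at the nonpositive
integers, and `f` vanishes at the positive integers. -/
def Samples (f : testFun) (G : Polynomial ℝ) : Prop :=
  (∀ k : ℕ, (f : ℝ → ℝ) (-k) = G.coeff k) ∧ ∀ k : ℕ, (f : ℝ → ℝ) (k + 1) = 0

lemma Samples.add {f g : testFun} {F G : Polynomial ℝ} (hf : Samples f F) (hg : Samples g G) :
    Samples (f + g) (F + G) :=
  ⟨fun k => by simp [hf.1 k, hg.1 k], fun k => by simp [hf.2 k, hg.2 k]⟩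

lemma Samples.smul {f : testFun} {F : Polynomial ℝ} (c : ℝ) (hf : Samples f F) :
    Samples (c • f) (Polynomial.C c * F) :=
  ⟨fun k => by simp [hf.1 k], fun k => by simp [hf.2 k]⟩

lemma Samples.shiftOp {f : testFun} {F : Polynomial ℝ} (hf : Samples f F) :
    Samples (shiftOp f) (Polynomial.X * F) := by
  constructor
  · rintro (_ | k)
    · simpa [_root_.shiftOp] using hf.2 0
    · rw [Polynomial.coeff_X_mul, ← hf.1 k]
      change (f : ℝ → ℝ) (-((k + 1 : ℕ) : ℝ) + 1) = _
      rw [show -((k + 1 : ℕ) : ℝ) + 1 = -k by push_cast; ring]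
  · intro k
    have := hf.2 (k + 1)
    push_cast at this
    exact this

lemma Samples.aeval {f : testFun} {F : Polynomial ℝ} (hf : Samples f F) (p : Polynomial ℝ) :
    Samples (Polynomial.aeval _root_.shiftOp p f) (p * F) := by
  induction p using Polynomial.induction_on generalizing f F with
  | C a => simpa [Module.algebraMap_end_apply] using hf.smul a
  | add p q hp hq => simpa [add_mul] using (hp hf).add (hq hf)
  | monomial n a ih =>
    have := ih hf.shiftOp
    rw [pow_succ, ← mul_assoc, map_mul, Polynomial.aeval_X, mul_assoc _ Polynomial.X]
    exact this

lemma exists_samples {f : testFun} (hf : ∀ k : ℕ, (f : ℝ → ℝ) (k + 1) = 0) :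
    ∃ G : Polynomial ℝ, Samples f G := by
  obtain ⟨_, R, hR⟩ := f.2
  obtain ⟨M, hM⟩ := exists_nat_ge R
  refine ⟨∑ i ∈ Finset.range M, Polynomial.monomial i ((f : ℝ → ℝ) (-i)), fun k => ?_, hf⟩
  simp only [Polynomial.finsetSum_coeff, Polynomial.coeff_monomial]
  rw [Finset.sum_ite_eq']
  split_ifs with h
  · rfl
  · refine hR _ ?_
    have : (M : ℝ) ≤ k := by exact_mod_cast not_lt.1 (by simpa using h)
    simp only [abs_neg, Nat.abs_cast]
    linarith

lemma Samples.isCoprime {f : testFun} {G : Polynomial ℝ} (hG : Samples f G)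
    (h0 : ∀ x, 0 ≤ (f : ℝ → ℝ) x) (hpos : 0 < (f : ℝ → ℝ) 0) (N : ℕ) (c : ℝ) (hc : c ≠ 0) :
    IsCoprime G ((Polynomial.X - 1) ^ N * Polynomial.C c) := by
  refine IsCoprime.mul_right (IsCoprime.pow_right ?_)
    ((isCoprime_one_right).of_isCoprime_of_dvd_right
      ((Polynomial.isUnit_C.2 hc.isUnit).dvd))
  have h1 : 0 < G.eval 1 := by
    rw [Polynomial.eval_eq_sum_range]
    refine Finset.sum_pos' (fun i _ => ?_) ⟨0, by simp, ?_⟩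
    · rw [← hG.1]; simpa using h0 _
    · rw [← hG.1]; simpa using hpos
  have h2 : IsCoprime G (Polynomial.X - Polynomial.C 1) :=
    ((Polynomial.irreducible_X_sub_C (1 : ℝ)).coprime_iff_not_dvd.2 (fun h =>
      h1.ne' (Polynomial.dvd_iff_isRoot.1 h))).symm
  simpa using h2

lemma avgOp_nonneg {f : testFun} (h0 : ∀ x, 0 ≤ (f : ℝ → ℝ) x) (x : ℝ) :
    0 ≤ (avgOp f : ℝ → ℝ) x :=
  intervalIntegral.integral_nonneg (by linarith) fun t _ => h0 t

lemma avgOp_pos {f : testFun} (h0 : ∀ x, 0 ≤ (f : ℝ → ℝ) x)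
    (hpos : ∃ t ∈ Set.Icc (0 : ℝ) 1, 0 < (f : ℝ → ℝ) t) : 0 < (avgOp f : ℝ → ℝ) 0 := by
  change 0 < ∫ t in (0 : ℝ)..0 + 1, (f : ℝ → ℝ) t
  rw [zero_add]
  exact intervalIntegral.integral_pos one_pos (testFun_continuous f).continuousOn
    (fun t _ => h0 t) hpos

lemma avgOp_eq_zero {f : testFun} {x : ℝ} (h : ∀ t, x ≤ t → t ≤ x + 1 → (f : ℝ → ℝ) t = 0) :
    (avgOp f : ℝ → ℝ) x = 0 := by
  change ∫ t in x..x + 1, (f : ℝ → ℝ) t = 0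
  rw [intervalIntegral.integral_congr (g := fun _ => (0 : ℝ))]
  · simp
  · intro t ht
    rw [Set.uIcc_of_le (by linarith)] at ht
    exact h t ht.1 ht.2

lemma exists_testFun_bump : ∃ w : testFun, (∀ x, 0 ≤ (w : ℝ → ℝ) x) ∧
    0 < (w : ℝ → ℝ) (1 / 2) ∧ (∀ x, 1 ≤ x → (w : ℝ → ℝ) x = 0) ∧
    ∀ x, x ≤ 0 → (w : ℝ → ℝ) x = 0 := by
  let b : ContDiffBump (1 / 2 : ℝ) := ⟨1 / 4, 1 / 2, by norm_num, by norm_num⟩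
  have hb : ∀ x, 1 / 2 ≤ |x - 1 / 2| → b x = 0 := fun x hx =>
    b.zero_of_le_dist (by rwa [Real.dist_eq])
  refine ⟨⟨b, b.contDiff, 1, fun x hx => hb x ?_⟩, fun x => b.nonneg, ?_, fun x hx => hb x ?_,
    fun x hx => hb x ?_⟩
  · have := abs_sub_abs_le_abs_sub x (1 / 2)
    rw [abs_of_pos (show (0 : ℝ) < 1 / 2 by norm_num)] at this
    linarith
  · have : b (1 / 2) = 1 := b.one_of_mem_closedBall (by simp [b])
    change 0 < b (1 / 2)
    rw [this]
    exact one_pos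
  · exact le_trans (by linarith) (le_abs_self _)
  · exact le_trans (by linarith) (neg_le_abs _)

lemma exists_samples_one (N : ℕ) : ∃ ψ : testFun, Samples ((avgOp ^ (N + 1)) ψ) 1 := by
  obtain ⟨w, hw0, hwpos, hw1, hwn⟩ := exists_testFun_bump
  have hnn : ∀ j : ℕ, ∀ x, 0 ≤ ((avgOp ^ j) w : ℝ → ℝ) x := by
    intro j
    induction j with
    | zero => exact hw0
    | succ j ih => rw [pow_succ']; exact avgOp_nonneg ih
  have hz : ∀ j : ℕ, ∀ x, 1 ≤ x → ((avgOp ^ j) w : ℝ → ℝ) x = 0 := by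
    intro j
    induction j with
    | zero => exact hw1
    | succ j ih =>
      intro x hx
      rw [pow_succ']
      exact avgOp_eq_zero fun t ht _ => ih t (hx.trans ht)
  have hpos : ∀ j : ℕ, 0 < ((avgOp ^ (j + 1)) w : ℝ → ℝ) 0 := by
    intro j
    induction j with
    | zero => simpa using avgOp_pos hw0 ⟨1 / 2, by norm_num, hwpos⟩
    | succ j ih => rw [pow_succ']; exact avgOp_pos (hnn _) ⟨0, by simp, ih⟩
  obtain ⟨G, hG⟩ := exists_samples (f := (avgOp ^ (N + 1)) w) fun k => hz _ _ (by simp)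
  set c := (avgOp w : ℝ → ℝ) 0 with hc
  have hcpos : 0 < c := by simpa using hpos 0
  have hS : Samples (avgOp w) (Polynomial.C c) := by
    refine ⟨?_, fun k => by simpa using hz 1 (k + 1) (by simp)⟩
    rintro (_ | k)
    · simp [hc]
    · rw [Polynomial.coeff_C_succ]
      refine avgOp_eq_zero fun t _ ht => hwn t (ht.trans ?_)
      push_cast
      linarith [(Nat.cast_nonneg k : (0 : ℝ) ≤ k)]
  have hH : Samples ((avgOp ^ (N + 1)) ((derivOp ^ N) w))
      ((Polynomial.X - 1) ^ N * Polynomial.C c) := by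
    have hcomm : Commute avgOp derivOp := by
      rw [Commute, SemiconjBy, derivOp_mul_avgOp, avgOp_mul_derivOp]
    have hcs : Commute avgOp (shiftOp - 1) :=
      by
      rw [← derivOp_mul_avgOp]
      exact hcomm.mul_right (Commute.refl _)
    have : avgOp ^ (N + 1) * derivOp ^ N =
        Polynomial.aeval shiftOp ((Polynomial.X - 1 : Polynomial ℝ) ^ N) * avgOp := by
      rw [pow_succ', mul_assoc, ← hcomm.mul_pow, avgOp_mul_derivOp, (hcs.pow_right N).eq]
      simp
    rw [← Module.End.mul_apply, this]
    exact hS.aeval _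
  obtain ⟨p, q, hpq⟩ := hG.isCoprime (hnn _) (hpos N) N c hcpos.ne'
  refine ⟨Polynomial.aeval shiftOp p w + Polynomial.aeval shiftOp q ((derivOp ^ N) w), ?_⟩
  have hcp : ∀ r : Polynomial ℝ, ∀ f : testFun,
      (avgOp ^ (N + 1)) (Polynomial.aeval shiftOp r f) =
        Polynomial.aeval shiftOp r ((avgOp ^ (N + 1)) f) := by
    intro r f
    have : Commute (avgOp ^ (N + 1)) (Polynomial.aeval shiftOp r) := by
      refine Commute.pow_left ?_ _
      exact Polynomial.induction_on r (fun a => by simpa using Algebra.commute_algebraMap_right a avgOp)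
        (fun p q hp hq => by simpa using hp.add_right hq)
        (fun n a _ => by
          simpa using (Algebra.commute_algebraMap_right a avgOp).mul_right
            (commute_avgOp_shiftOp.pow_right (n + 1)))
    exact LinearMap.congr_fun this.eq f
  rw [map_add, hcp, hcp, ← hpq]
  exact (hG.aeval p).add (hH.aeval q)

/-- A compactly supported smooth cardinal function `Φ 0` on the line whose successive derivatives
are differences of compactly supported smooth functions. -/
lemma exists_cardinal_kernels (N : ℕ) : ∃ (Φ : ℕ → ℝ → ℝ) (R : ℕ),
    (∀ j, ContDiff ℝ (⊤ : ℕ∞) (Φ j)) ∧ (∀ j x, (R : ℝ) ≤ |x| → Φ j x = 0) ∧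
    Φ 0 0 = 1 ∧ (∀ k : ℤ, k ≠ 0 → Φ 0 k = 0) ∧
    ∀ j < N, ∀ x, HasDerivAt (Φ j) (Φ (j + 1) (x + 1) - Φ (j + 1) x) x := by
  obtain ⟨ψ, hψ⟩ := exists_samples_one N
  have hb : ∀ j : ℕ, ∃ R : ℕ, ∀ x, (R : ℝ) ≤ |x| → ((avgOp ^ j) ψ : ℝ → ℝ) x = 0 := by
    intro j
    obtain ⟨_, R, hR⟩ := ((avgOp ^ j) ψ).2
    obtain ⟨M, hM⟩ := exists_nat_ge R
    exact ⟨M, fun x hx => hR x (hM.trans hx)⟩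
  choose R hR using hb
  refine ⟨fun j => ((avgOp ^ (N + 1 - j)) ψ : testFun), ∑ j ∈ Finset.range (N + 2), R j,
    fun j => ((avgOp ^ (N + 1 - j)) ψ).2.1, fun j x hx => hR _ x (le_trans ?_ hx), ?_, ?_, ?_⟩
  · exact_mod_cast Finset.single_le_sum (f := R) (fun _ _ => Nat.zero_le _)
      (Finset.mem_range.2 (by omega))
  · simpa using hψ.1 0
  · intro k hk
    rcases lt_or_gt_of_ne hk with h | h
    · obtain ⟨i, rfl⟩ : ∃ i : ℕ, k = -((i : ℤ) + 1) := ⟨(-k - 1).toNat, by omega⟩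
      have := hψ.1 (i + 1)
      simpa [Polynomial.coeff_one] using this
    · obtain ⟨i, rfl⟩ : ∃ i : ℕ, k = (i : ℤ) + 1 := ⟨(k - 1).toNat, by omega⟩
      simpa using hψ.2 i
  · intro j hj x
    beta_reduce
    rw [show N + 1 - j = (N + 1 - (j + 1)) + 1 by omega]
    generalize N + 1 - (j + 1) = i
    rw [pow_succ', Module.End.mul_apply]
    exact hasDerivAt_unit_integral (testFun_continuous _) x

section Directional

variable {E : Type*} [NormedAddCommGroup E] [NormedSpace ℝ E]

/-- Directional derivative in the constant direction `v`. -/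
def dirDeriv (v : E) (f : E → ℂ) : E → ℂ := fun q => fderiv ℝ f q v

/-- Forward difference with step `v`. -/
def stepDiff (v : E) (f : E → ℂ) : E → ℂ := fun q => f (q + v) - f q

lemma ContDiff.dirDeriv {f : E → ℂ} (hf : ContDiff ℝ (⊤ : ℕ∞) f) (v : E) :
    ContDiff ℝ (⊤ : ℕ∞) (dirDeriv v f) :=
  (hf.fderiv_right (m := (⊤ : ℕ∞)) (by simp)).clm_apply contDiff_const

lemma ContDiff.stepDiff {f : E → ℂ} (hf : ContDiff ℝ (⊤ : ℕ∞) f) (v : E) :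
    ContDiff ℝ (⊤ : ℕ∞) (stepDiff v f) :=
  (hf.comp (contDiff_id.add contDiff_const)).sub hf

lemma ContDiff.foldr_dirDeriv {f : E → ℂ} (hf : ContDiff ℝ (⊤ : ℕ∞) f) (l : List E) :
    ContDiff ℝ (⊤ : ℕ∞) (l.foldr _root_.dirDeriv f) := by
  induction l with
  | nil => exact hf
  | cons v l ih => exact ih.dirDeriv v

lemma ContDiff.foldr_stepDiff {f : E → ℂ} (hf : ContDiff ℝ (⊤ : ℕ∞) f) (l : List E) :
    ContDiff ℝ (⊤ : ℕ∞) (l.foldr _root_.stepDiff f) := by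
  induction l with
  | nil => exact hf
  | cons v l ih => exact ih.stepDiff v

lemma dirDeriv_comm {f : E → ℂ} (hf : ContDiff ℝ (⊤ : ℕ∞) f) (v w : E) :
    dirDeriv v (dirDeriv w f) = dirDeriv w (dirDeriv v f) := by
  have hd : Differentiable ℝ (fderiv ℝ f) :=
    (hf.fderiv_right (m := (⊤ : ℕ∞)) (by simp)).differentiable (by simp)
  have key : ∀ (a b : E) (q : E), dirDeriv a (dirDeriv b f) q = fderiv ℝ (fderiv ℝ f) q a b := by
    intro a b q
    have h := (hd q).hasFDerivAt.clm_apply (hasFDerivAt_const b q)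
    unfold dirDeriv
    rw [h.fderiv]
    simp
  funext q
  rw [key, key]
  exact (hf.contDiffAt.isSymmSndFDerivAt
    (by
    rw [minSmoothness_of_isRCLikeNormedField]
    exact WithTop.coe_le_coe.2 (le_top : (2 : ℕ∞) ≤ ⊤))) v w

lemma dirDeriv_stepDiff_comm {f : E → ℂ} (hf : ContDiff ℝ (⊤ : ℕ∞) f) (v w : E) :
    dirDeriv v (stepDiff w f) = stepDiff w (dirDeriv v f) := by
  have hd : Differentiable ℝ f := hf.differentiable (by simp)
  funext q
  unfold dirDeriv stepDiff
  have hw : Differentiable ℝ fun q => f (q + w) := hd.comp (differentiable_id.add_const w)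
  rw [fderiv_fun_sub (hw q) (hd q), fderiv_comp_add_right]
  rfl

lemma foldr_dirDeriv_comm {f : E → ℂ} (hf : ContDiff ℝ (⊤ : ℕ∞) f) (v : E) (l : List E) :
    l.foldr dirDeriv (dirDeriv v f) = dirDeriv v (l.foldr dirDeriv f) := by
  induction l with
  | nil => rfl
  | cons w l ih =>
    rw [List.foldr_cons, ih, List.foldr_cons, dirDeriv_comm (hf.foldr_dirDeriv l)]

lemma foldr_dirDeriv_foldr_comm {f : E → ℂ} (hf : ContDiff ℝ (⊤ : ℕ∞) f) (k l : List E) :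
    l.foldr dirDeriv (k.foldr dirDeriv f) = k.foldr dirDeriv (l.foldr dirDeriv f) := by
  induction k with
  | nil => rfl
  | cons w k ih =>
    rw [List.foldr_cons, foldr_dirDeriv_comm (hf.foldr_dirDeriv k), ih, List.foldr_cons]

lemma foldr_stepDiff_dirDeriv_comm {f : E → ℂ} (hf : ContDiff ℝ (⊤ : ℕ∞) f) (v : E)
    (l : List E) : l.foldr stepDiff (dirDeriv v f) = dirDeriv v (l.foldr stepDiff f) := by
  induction l with
  | nil => rfl
  | cons w l ih =>
    rw [List.foldr_cons, ih, List.foldr_cons, dirDeriv_stepDiff_comm (hf.foldr_stepDiff l)]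

lemma foldr_stepDiff_foldr_dirDeriv_comm {f : E → ℂ} (hf : ContDiff ℝ (⊤ : ℕ∞) f)
    (k l : List E) :
    l.foldr stepDiff (k.foldr dirDeriv f) = k.foldr dirDeriv (l.foldr stepDiff f) := by
  induction k with
  | nil => rfl
  | cons w k ih =>
    rw [List.foldr_cons, foldr_stepDiff_dirDeriv_comm (hf.foldr_dirDeriv k), ih, List.foldr_cons]

lemma norm_stepDiff_le {f : E → ℂ} (hf : ContDiff ℝ (⊤ : ℕ∞) f) {v : E} (hv : ‖v‖ ≤ 1)
    {C : ℝ} (q : E) (hC : ∀ p, ‖p - q‖ ≤ 1 → ‖dirDeriv v f p‖ ≤ C) :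
    ‖stepDiff v f q‖ ≤ C := by
  have hd : Differentiable ℝ f := hf.differentiable (by simp)
  have hg : ∀ t : ℝ, HasDerivAt (fun t : ℝ => f (q + t • v)) (dirDeriv v f (q + t • v)) t := by
    intro t
    have h1 : HasDerivAt (fun t : ℝ => q + t • v) v t := by
      simpa using ((hasDerivAt_id t).smul_const v).const_add q
    exact (hd _).hasFDerivAt.comp_hasDerivAt t h1
  have := norm_image_sub_le_of_norm_deriv_le_segment_01' (f := fun t : ℝ => f (q + t • v))
    (C := C) (fun t _ => (hg t).hasDerivWithinAt) (fun t ht => hC _ (by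
      rw [add_sub_cancel_left, norm_smul, Real.norm_of_nonneg ht.1]
      nlinarith [ht.1, ht.2, norm_nonneg v]))
  simpa [stepDiff] using this

/-- Iterated differences are bounded by the corresponding derivatives nearby. -/
lemma norm_foldr_stepDiff_le {f : E → ℂ} (hf : ContDiff ℝ (⊤ : ℕ∞) f) (l : List E)
    (hl : ∀ v ∈ l, ‖v‖ ≤ 1) {C : ℝ} (q : E)
    (hC : ∀ p, ‖p - q‖ ≤ l.length → ‖l.foldr dirDeriv f p‖ ≤ C) :
    ‖l.foldr stepDiff f q‖ ≤ C := by
  induction l generalizing f q with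
  | nil => exact hC q (by simp)
  | cons v l ih =>
    refine norm_stepDiff_le (hf.foldr_stepDiff l) (hl v (by simp)) q fun p hp => ?_
    rw [← foldr_stepDiff_dirDeriv_comm hf]
    refine ih (hf.dirDeriv v) (fun w hw => hl w (by simp [hw])) p fun p' hp' => ?_
    rw [foldr_dirDeriv_comm hf]
    refine hC p' ?_
    have := norm_sub_le_norm_sub_add_norm_sub p' p q
    push_cast [List.length_cons]
    linarith

end Directional

section Slices

variable {n : ℕ}

/-- The `j`-th coordinate direction in the first factor of `ℝⁿ × ℝⁿ`. -/
def dirFst (j : Fin n) : (Fin n → ℝ) × (Fin n → ℝ) := (Pi.single j 1, 0)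

/-- The `j`-th coordinate direction in the second factor of `ℝⁿ × ℝⁿ`. -/
def dirSnd (j : Fin n) : (Fin n → ℝ) × (Fin n → ℝ) := (0, Pi.single j 1)

lemma foldr_pd_fst {f : (Fin n → ℝ) × (Fin n → ℝ) → ℂ} (hf : ContDiff ℝ (⊤ : ℕ∞) f)
    (l : List (Fin n)) (ξ x : Fin n → ℝ) :
    l.foldr pd (fun x => f (x, ξ)) x = (l.map dirFst).foldr dirDeriv f (x, ξ) := by
  induction l generalizing x with
  | nil => rfl
  | cons j l ih =>
    rw [List.foldr_cons, funext ih, List.map_cons, List.foldr_cons]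
    have hd := ((hf.foldr_dirDeriv (l.map dirFst)).differentiable (by simp) (x, ξ)).hasFDerivAt
    have h := HasFDerivAt.comp (f := fun x => (x, ξ)) x hd (hasFDerivAt_prodMk_left x ξ)
    change fderiv ℝ ((l.map dirFst).foldr dirDeriv f ∘ fun x => (x, ξ)) x _ = _
    rw [h.fderiv]
    rfl

lemma foldr_pd_snd {f : (Fin n → ℝ) × (Fin n → ℝ) → ℂ} (hf : ContDiff ℝ (⊤ : ℕ∞) f)
    (l : List (Fin n)) (x ξ : Fin n → ℝ) :
    l.foldr pd (fun ξ => f (x, ξ)) ξ = (l.map dirSnd).foldr dirDeriv f (x, ξ) := by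
  induction l generalizing ξ with
  | nil => rfl
  | cons j l ih =>
    rw [List.foldr_cons, funext ih, List.map_cons, List.foldr_cons]
    have hd := ((hf.foldr_dirDeriv (l.map dirSnd)).differentiable (by simp) (x, ξ)).hasFDerivAt
    have h := HasFDerivAt.comp (f := fun ξ => (x, ξ)) ξ hd (hasFDerivAt_prodMk_right x ξ)
    change fderiv ℝ ((l.map dirSnd).foldr dirDeriv f ∘ fun ξ => (x, ξ)) ξ _ = _
    rw [h.fderiv]
    rfl

lemma castZ_add_single (ξ : Fin n → ℤ) (j : Fin n) :
    castZ (ξ + Pi.single j 1) = castZ ξ + Pi.single j 1 := by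
  funext i
  by_cases h : i = j
  · subst h; simp [castZ]
  · simp [castZ, h]

lemma foldr_dd_castZ (f : (Fin n → ℝ) × (Fin n → ℝ) → ℂ) (l : List (Fin n)) (x : Fin n → ℝ)
    (ξ : Fin n → ℤ) :
    l.foldr dd (fun ξ => f (x, castZ ξ)) ξ = (l.map dirSnd).foldr stepDiff f (x, castZ ξ) := by
  induction l generalizing ξ with
  | nil => rfl
  | cons j l ih =>
    rw [List.foldr_cons, funext ih, List.map_cons, List.foldr_cons]
    simp only [dd, stepDiff, dirSnd, castZ_add_single, Prod.mk_add_mk, add_zero]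

lemma symbDxDξ_eq {a : (Fin n → ℝ) → (Fin n → ℝ) → ℂ}
    (ha : ContDiff ℝ (⊤ : ℕ∞) fun q : (Fin n → ℝ) × (Fin n → ℝ) => a q.1 q.2)
    (β α : Fin n → ℕ) (x ξ : Fin n → ℝ) :
    symbDxDξ β α a x ξ = ((mIdxList α).map dirSnd).foldr dirDeriv
      (((mIdxList β).map dirFst).foldr dirDeriv fun q => a q.1 q.2) (x, ξ) := by
  rw [foldr_dirDeriv_foldr_comm ha, ← foldr_pd_fst (ha.foldr_dirDeriv _)]
  unfold symbDxDξ pdM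
  refine congrFun (congrArg (fun F => List.foldr pd F (mIdxList β)) (funext fun x' => ?_)) x
  rw [← foldr_pd_snd ha]

lemma symbDxD_castZ_eq {a : (Fin n → ℝ) → (Fin n → ℝ) → ℂ}
    (ha : ContDiff ℝ (⊤ : ℕ∞) fun q : (Fin n → ℝ) × (Fin n → ℝ) => a q.1 q.2)
    (β α : Fin n → ℕ) (x : Fin n → ℝ) (ξ : Fin n → ℤ) :
    symbDxD β α (fun x' ξ' => a x' (castZ ξ')) x ξ =
      ((mIdxList α).map dirSnd).foldr stepDiff
        (((mIdxList β).map dirFst).foldr dirDeriv fun q => a q.1 q.2) (x, castZ ξ) := by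
  rw [foldr_stepDiff_foldr_dirDeriv_comm ha, ← foldr_pd_fst (ha.foldr_stepDiff _)]
  unfold symbDxD pdM
  refine congrFun (congrArg (fun F => List.foldr pd F (mIdxList β)) (funext fun x' => ?_)) x
  rw [← foldr_dd_castZ]
  rfl

end Slices

section Bracket

variable {n : ℕ}

lemma jbR_pos (ξ : Fin n → ℝ) : 0 < jbR ξ :=
  Real.sqrt_pos.2 (by have := Finset.sum_nonneg (fun j (_ : j ∈ Finset.univ) => sq_nonneg (ξ j))
                      linarith)

lemma jbR_le (R : ℝ) (ξ η : Fin n → ℝ) (h : ∀ j, |ξ j - η j| ≤ R) :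
    jbR ξ ≤ √(2 + 2 * n * R ^ 2) * jbR η := by
  unfold jbR
  rw [← Real.sqrt_mul (by positivity)]
  refine Real.sqrt_le_sqrt ?_
  have h1 : ∀ j, ξ j ^ 2 ≤ 2 * η j ^ 2 + 2 * R ^ 2 := fun j => by
    have := sq_le_sq' (by linarith [neg_le_of_abs_le (h j)]) (le_of_abs_le (h j))
    nlinarith [sq_nonneg (ξ j - 2 * η j)]
  have h2 := Finset.sum_le_sum fun j (_ : j ∈ Finset.univ) => h1 j
  rw [Finset.sum_add_distrib, ← Finset.mul_sum] at h2
  simp only [Finset.sum_const, Finset.card_univ, Fintype.card_fin, nsmul_eq_mul] at h2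
  have h3 := Finset.sum_nonneg (fun j (_ : j ∈ Finset.univ) => sq_nonneg (η j))
  have h4 : 0 ≤ 2 * n * R ^ 2 * ∑ j, η j ^ 2 := by positivity
  linarith

/-- Powers of the Japanese bracket are comparable at points of bounded distance. -/
lemma exists_jbR_rpow_le (n : ℕ) (R s : ℝ) : ∃ C : ℝ, 0 < C ∧ ∀ ξ η : Fin n → ℝ,
    (∀ j, |ξ j - η j| ≤ R) → jbR ξ ^ s ≤ C * jbR η ^ s := by
  have hc : 0 < √(2 + 2 * n * R ^ 2) := Real.sqrt_pos.2 (by positivity)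
  refine ⟨√(2 + 2 * n * R ^ 2) ^ |s|, by positivity, fun ξ η h => ?_⟩
  have hξ := jbR_pos ξ
  have hη := jbR_pos η
  rcases le_total 0 s with hs | hs
  · rw [abs_of_nonneg hs, ← Real.mul_rpow hc.le hη.le]
    exact Real.rpow_le_rpow hξ.le (jbR_le R ξ η h) hs
  · rw [abs_of_nonpos hs, Real.rpow_neg hc.le, ← Real.inv_rpow hc.le,
      ← Real.mul_rpow (inv_nonneg.2 hc.le) hη.le]
    refine Real.rpow_le_rpow_of_nonpos (by positivity) ?_ hs
    rw [inv_mul_le_iff₀ hc]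
    exact jbR_le R η ξ fun j => by rw [abs_sub_comm]; exact h j

end Bracket

lemma mIdxList_length {n : ℕ} (α : Fin n → ℕ) : (mIdxList α).length = ∑ j, α j := by
  simp [mIdxList, List.length_flatMap, Fin.sum_univ_def]

lemma exists_symbDxD_castZ_le {n : ℕ} {a : (Fin n → ℝ) → (Fin n → ℝ) → ℂ}
    (ha : ContDiff ℝ (⊤ : ℕ∞) fun q : (Fin n → ℝ) × (Fin n → ℝ) => a q.1 q.2)
    (α β : Fin n → ℕ) (s : ℝ)
    (h : ∃ C : ℝ, 0 < C ∧ ∀ x ξ : Fin n → ℝ, ‖symbDxDξ β α a x ξ‖ ≤ C * jbR ξ ^ s) :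
    ∃ C : ℝ, 0 < C ∧ ∀ (x : Fin n → ℝ) (ξ : Fin n → ℤ),
      ‖symbDxD β α (fun x' ξ' => a x' (castZ ξ')) x ξ‖ ≤ C * jb ξ ^ s := by
  obtain ⟨C, hC0, hC⟩ := h
  obtain ⟨K, hK0, hK⟩ := exists_jbR_rpow_le n ((mIdxList α).length : ℝ) s
  refine ⟨C * K, by positivity, fun x ξ => ?_⟩
  rw [symbDxD_castZ_eq ha]
  refine norm_foldr_stepDiff_le (ha.foldr_dirDeriv _) _ ?_ _ fun p hp => ?_
  · intro v hv
    obtain ⟨j, _, rfl⟩ := List.mem_map.1 hv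
    simp [dirSnd, Prod.norm_def, Pi.norm_single]
  · obtain ⟨y, η⟩ := p
    rw [← symbDxDξ_eq ha]
    refine (hC y η).trans ?_
    rw [mul_assoc]
    refine mul_le_mul_of_nonneg_left (hK _ _ fun j => ?_) hC0.le
    rw [List.length_map] at hp
    exact ((norm_le_pi_norm (η - castZ ξ) j).trans (norm_snd_le ((y, η) - (x, castZ ξ)))).trans hp

section Extension

variable {n : ℕ}

/-- The tensor-product kernel `∏ᵢ Φ_{γᵢ}(ξᵢ)`. -/
def tensorKer (Φ : ℕ → ℝ → ℝ) (γ : Fin n → ℕ) (ξ : Fin n → ℝ) : ℝ := ∏ i, Φ (γ i) (ξ i)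

/-- The function `ξ ↦ ∑_η K_γ(ξ - η) b(η)` on `ℝⁿ` associated to a lattice function `b`. -/
def kerExt (Φ : ℕ → ℝ → ℝ) (γ : Fin n → ℕ) (b : (Fin n → ℤ) → ℂ) (ξ : Fin n → ℝ) : ℂ :=
  ∑ᶠ η : Fin n → ℤ, (tensorKer Φ γ (ξ - castZ η) : ℂ) * b η

/-- The lattice points in a box of side `2 M` around `ξ`. -/
def latticeBox (M : ℕ) (ξ : Fin n → ℝ) : Finset (Fin n → ℤ) :=
  Fintype.piFinset fun i => Finset.Icc (⌊ξ i⌋ - (M : ℤ)) (⌊ξ i⌋ + M)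

lemma card_latticeBox (M : ℕ) (ξ : Fin n → ℝ) : (latticeBox M ξ).card = (2 * M + 1) ^ n := by
  have : ∀ z : ℤ, (z + M + 1 - (z - M)).toNat = 2 * M + 1 := fun z => by omega
  simp [latticeBox, Fintype.card_piFinset, this]

lemma abs_sub_le_of_mem_latticeBox {M : ℕ} {ξ : Fin n → ℝ} {η : Fin n → ℤ}
    (h : η ∈ latticeBox M ξ) (i : Fin n) : |(η i : ℝ) - ξ i| ≤ M + 1 := by
  have hi := Finset.mem_Icc.1 (Fintype.mem_piFinset.1 h i)
  have h1 : ((⌊ξ i⌋ : ℤ) : ℝ) - M ≤ η i := by exact_mod_cast hi.1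
  have h2 : (η i : ℝ) ≤ (⌊ξ i⌋ : ℤ) + M := by exact_mod_cast hi.2
  have h3 := Int.floor_le (ξ i)
  have h4 := Int.lt_floor_add_one (ξ i)
  exact abs_le.2 ⟨by linarith, by linarith⟩

lemma tensorKer_eq_zero {Φ : ℕ → ℝ → ℝ} {R : ℕ} (hR : ∀ j x, (R : ℝ) ≤ |x| → Φ j x = 0)
    (γ : Fin n → ℕ) {ξ ζ : Fin n → ℝ} (hζ : ‖ζ - ξ‖ ≤ 1) {η : Fin n → ℤ}
    (hη : η ∉ latticeBox (R + 2) ξ) : tensorKer Φ γ (ζ - castZ η) = 0 := by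
  simp only [latticeBox, Fintype.mem_piFinset, Finset.mem_Icc, not_forall] at hη
  obtain ⟨i, hi⟩ := hη
  refine Finset.prod_eq_zero (Finset.mem_univ i) (hR _ _ ?_)
  have h1 := abs_le.1 ((norm_le_pi_norm (ζ - ξ) i).trans hζ)
  have h3 := Int.floor_le (ξ i)
  have h4 := Int.lt_floor_add_one (ξ i)
  simp only [Pi.sub_apply, castZ] at h1 ⊢
  rcases not_and_or.1 hi with h | h
  · have : (η i : ℝ) ≤ (⌊ξ i⌋ : ℤ) - (R + 2 : ℕ) - 1 := by
      have : η i ≤ ⌊ξ i⌋ - (R + 2 : ℕ) - 1 := by omega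
      exact_mod_cast this
    push_cast at this
    refine le_trans ?_ (le_abs_self _)
    linarith
  · have : ((⌊ξ i⌋ : ℤ) : ℝ) + (R + 2 : ℕ) + 1 ≤ η i := by
      have : ⌊ξ i⌋ + (R + 2 : ℕ) + 1 ≤ η i := by omega
      exact_mod_cast this
    push_cast at this
    refine le_trans ?_ (neg_le_abs _)
    linarith

lemma support_tensorKer_subset {Φ : ℕ → ℝ → ℝ} {R : ℕ}
    (hR : ∀ j x, (R : ℝ) ≤ |x| → Φ j x = 0) (γ : Fin n → ℕ) {ξ ζ : Fin n → ℝ}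
    (hζ : ‖ζ - ξ‖ ≤ 1) (b : (Fin n → ℤ) → ℂ) :
    (Function.support fun η : Fin n → ℤ => (tensorKer Φ γ (ζ - castZ η) : ℂ) * b η) ⊆
      latticeBox (R + 2) ξ := by
  intro η hη
  by_contra h
  exact hη (by simp [tensorKer_eq_zero hR γ hζ h])

lemma kerExt_eq_sum {Φ : ℕ → ℝ → ℝ} {R : ℕ} (hR : ∀ j x, (R : ℝ) ≤ |x| → Φ j x = 0)
    (γ : Fin n → ℕ) {ξ ζ : Fin n → ℝ} (hζ : ‖ζ - ξ‖ ≤ 1) (b : (Fin n → ℤ) → ℂ) :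
    kerExt Φ γ b ζ =
      ∑ η ∈ latticeBox (R + 2) ξ, (tensorKer Φ γ (ζ - castZ η) : ℂ) * b η :=
  finsum_eq_sum_of_support_subset _ (support_tensorKer_subset hR γ hζ b)

lemma contDiff_tensorKer {Φ : ℕ → ℝ → ℝ} (hΦ : ∀ j, ContDiff ℝ (⊤ : ℕ∞) (Φ j))
    (γ : Fin n → ℕ) : ContDiff ℝ (⊤ : ℕ∞) (tensorKer Φ γ) :=
  contDiff_prod fun i _ => (hΦ (γ i)).comp (contDiff_apply ℝ ℝ i)

lemma fderiv_tensorKer_single {Φ : ℕ → ℝ → ℝ} (hΦ : ∀ j, ContDiff ℝ (⊤ : ℕ∞) (Φ j))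
    {γ : Fin n → ℕ} {j : Fin n}
    (hj : ∀ x, HasDerivAt (Φ (γ j)) (Φ (γ j + 1) (x + 1) - Φ (γ j + 1) x) x) (ξ : Fin n → ℝ) :
    fderiv ℝ (tensorKer Φ γ) ξ (Pi.single j 1) =
      tensorKer Φ (γ + Pi.single j 1) (ξ + Pi.single j 1) -
        tensorKer Φ (γ + Pi.single j 1) ξ := by
  have hsplit : ∀ (γ' : Fin n → ℕ) (ζ : Fin n → ℝ), tensorKer Φ γ' ζ =
      Φ (γ' j) (ζ j) * ∏ i ∈ Finset.univ.erase j, Φ (γ' i) (ζ i) := fun γ' ζ =>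
    (Finset.mul_prod_erase _ (fun i => Φ (γ' i) (ζ i)) (Finset.mem_univ j)).symm
  have hne : ∀ i ∈ Finset.univ.erase j, i ≠ j := fun i hi => (Finset.mem_erase.1 hi).1
  have h1 : HasDerivAt (fun t : ℝ => tensorKer Φ γ (ξ + t • Pi.single j 1))
      (fderiv ℝ (tensorKer Φ γ) ξ (Pi.single j 1)) 0 := by
    have hl : HasDerivAt (fun t : ℝ => ξ + t • (Pi.single j 1 : Fin n → ℝ)) (Pi.single j 1) 0 := by
      simpa using ((hasDerivAt_id (0 : ℝ)).smul_const (Pi.single j 1 : Fin n → ℝ)).const_add ξ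
    have hd := ((contDiff_tensorKer hΦ γ).differentiable (by simp)
      (ξ + (0 : ℝ) • (Pi.single j 1 : Fin n → ℝ))).hasFDerivAt
    have h := hd.comp_hasDerivAt (0 : ℝ) hl
    rw [zero_smul, add_zero] at h
    exact h
  have h2 : (fun t : ℝ => tensorKer Φ γ (ξ + t • Pi.single j 1)) = fun t : ℝ =>
      Φ (γ j) (ξ j + t) * ∏ i ∈ Finset.univ.erase j, Φ (γ i) (ξ i) := by
    funext t
    rw [hsplit]
    congr 1
    · simp
    · exact Finset.prod_congr rfl fun i hi => by simp [hne i hi]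
  have h3 : HasDerivAt (fun t : ℝ =>
      Φ (γ j) (ξ j + t) * ∏ i ∈ Finset.univ.erase j, Φ (γ i) (ξ i))
      ((Φ (γ j + 1) (ξ j + 1) - Φ (γ j + 1) (ξ j)) *
        ∏ i ∈ Finset.univ.erase j, Φ (γ i) (ξ i)) 0 := by
    refine HasDerivAt.mul_const ?_ _
    have := hj (ξ j + 0)
    simpa using this.comp_const_add (ξ j) 0
  rw [h2] at h1
  rw [h1.unique h3, hsplit, hsplit, sub_mul]
  congr 2
  · simp
  · exact Finset.prod_congr rfl fun i hi => by simp [hne i hi]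
  · simp
  · exact Finset.prod_congr rfl fun i hi => by simp [hne i hi]

lemma pd_kerExt {Φ : ℕ → ℝ → ℝ} {R : ℕ} (hΦ : ∀ j, ContDiff ℝ (⊤ : ℕ∞) (Φ j))
    (hR : ∀ j x, (R : ℝ) ≤ |x| → Φ j x = 0) {γ : Fin n → ℕ} {j : Fin n}
    (hj : ∀ x, HasDerivAt (Φ (γ j)) (Φ (γ j + 1) (x + 1) - Φ (γ j + 1) x) x)
    (b : (Fin n → ℤ) → ℂ) :
    pd j (kerExt Φ γ b) = kerExt Φ (γ + Pi.single j 1) (dd j b) := by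
  funext ξ
  set γ' := γ + Pi.single j 1 with hγ'
  have hev : kerExt Φ γ b =ᶠ[nhds ξ] fun ζ =>
      ∑ η ∈ latticeBox (R + 2) ξ, (tensorKer Φ γ (ζ - castZ η) : ℂ) * b η := by
    filter_upwards [Metric.ball_mem_nhds ξ one_pos] with ζ hζ
    exact kerExt_eq_sum hR γ (mem_ball_iff_norm.1 hζ).le b
  have hterm : ∀ η : Fin n → ℤ, HasFDerivAt
      (fun ζ => (tensorKer Φ γ (ζ - castZ η) : ℂ) * b η)
      ((b η) • (Complex.ofRealCLM.comp (fderiv ℝ (tensorKer Φ γ) (ξ - castZ η)))) ξ := by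
    intro η
    have h := ((contDiff_tensorKer hΦ γ).differentiable (by simp) (ξ - castZ η)).hasFDerivAt
    have h' := h.comp ξ ((hasFDerivAt_id ξ).sub_const (castZ η))
    exact (Complex.ofRealCLM.hasFDerivAt.comp ξ h').mul_const (b η)
  have hn1 : ‖ξ + Pi.single j (1 : ℝ) - ξ‖ ≤ 1 := by simp [Pi.norm_single]
  have hn0 : ‖ξ - ξ‖ ≤ 1 := by simp
  have hA : (Function.support fun η : Fin n → ℤ =>
      (tensorKer Φ γ' (ξ + Pi.single j 1 - castZ η) : ℂ) * b η).Finite :=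
    (Finset.finite_toSet _).subset (support_tensorKer_subset hR γ' hn1 b)
  have hB : ∀ c : (Fin n → ℤ) → ℂ, (Function.support fun η : Fin n → ℤ =>
      (tensorKer Φ γ' (ξ - castZ η) : ℂ) * c η).Finite := fun c =>
    (Finset.finite_toSet _).subset (support_tensorKer_subset hR γ' hn0 c)
  have hpd : pd j (kerExt Φ γ b) ξ = ∑ η ∈ latticeBox (R + 2) ξ,
      ((tensorKer Φ γ' (ξ + Pi.single j 1 - castZ η) : ℂ) * b η -
        (tensorKer Φ γ' (ξ - castZ η) : ℂ) * b η) := by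
    unfold pd
    rw [hev.fderiv_eq, (HasFDerivAt.fun_sum fun η _ => hterm η).fderiv, sum_apply]
    refine Finset.sum_congr rfl fun η _ => ?_
    have := fderiv_tensorKer_single hΦ hj (ξ - castZ η)
    simp only [smul_apply, ContinuousLinearMap.comp_apply, this]
    rw [add_sub_right_comm]
    simp
    ring
  rw [hpd, Finset.sum_sub_distrib,
    ← finsum_eq_sum_of_support_subset _ (support_tensorKer_subset hR γ' hn1 b),
    ← finsum_eq_sum_of_support_subset _ (support_tensorKer_subset hR γ' hn0 b),
    ← finsum_comp_equiv (Equiv.addRight (Pi.single j (1 : ℤ)))]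
  simp only [Equiv.coe_addRight, castZ_add_single, add_sub_add_right_eq_sub]
  rw [← finsum_sub_distrib (hB _) (hB _)]
  exact finsum_congr fun η => (mul_sub _ _ _).symm

lemma foldr_pd_kerExt {Φ : ℕ → ℝ → ℝ} {R N : ℕ} (hΦ : ∀ j, ContDiff ℝ (⊤ : ℕ∞) (Φ j))
    (hR : ∀ j x, (R : ℝ) ≤ |x| → Φ j x = 0)
    (hder : ∀ j < N, ∀ x, HasDerivAt (Φ j) (Φ (j + 1) (x + 1) - Φ (j + 1) x) x)
    (b : (Fin n → ℤ) → ℂ) (l : List (Fin n)) (hl : l.length ≤ N) :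
    l.foldr pd (kerExt Φ 0 b) = kerExt Φ (fun i => l.count i) (l.foldr dd b) := by
  induction l with
  | nil => rfl
  | cons j l ih =>
    rw [List.length_cons] at hl
    rw [List.foldr_cons, ih (by omega), pd_kerExt hΦ hR (hder _ (by
      have := List.count_le_length (a := j) (l := l)
      omega)), List.foldr_cons]
    congr 1
    funext i
    by_cases h : i = j
    · subst h; simp
    · simp [h, Ne.symm h]

lemma contDiff_kerExt {Φ : ℕ → ℝ → ℝ} {R : ℕ} (hΦ : ∀ j, ContDiff ℝ (⊤ : ℕ∞) (Φ j))
    (hR : ∀ j x, (R : ℝ) ≤ |x| → Φ j x = 0) (γ : Fin n → ℕ)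
    {σ : (Fin n → ℝ) → (Fin n → ℤ) → ℂ} (hσ : ∀ η, ContDiff ℝ (⊤ : ℕ∞) fun x => σ x η) :
    ContDiff ℝ (⊤ : ℕ∞) fun q : (Fin n → ℝ) × (Fin n → ℝ) => kerExt Φ γ (σ q.1) q.2 := by
  refine contDiff_iff_contDiffAt.2 fun q₀ => ?_
  have hev : (fun q : (Fin n → ℝ) × (Fin n → ℝ) => kerExt Φ γ (σ q.1) q.2) =ᶠ[nhds q₀]
      fun q => ∑ η ∈ latticeBox (R + 2) q₀.2,
        (tensorKer Φ γ (q.2 - castZ η) : ℂ) * σ q.1 η := by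
    filter_upwards [continuous_snd.continuousAt.preimage_mem_nhds
      (Metric.ball_mem_nhds q₀.2 one_pos)] with q hq
    exact kerExt_eq_sum hR γ (mem_ball_iff_norm.1 hq).le _
  refine ContDiffAt.congr_of_eventuallyEq (ContDiff.contDiffAt ?_) hev
  refine ContDiff.sum fun η _ => ContDiff.mul ?_ ((hσ η).comp contDiff_fst)
  exact Complex.ofRealCLM.contDiff.comp
    ((contDiff_tensorKer hΦ γ).comp (contDiff_snd.sub contDiff_const))

lemma kerExt_castZ {Φ : ℕ → ℝ → ℝ} (h0 : Φ 0 0 = 1) (h1 : ∀ k : ℤ, k ≠ 0 → Φ 0 k = 0)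
    (b : (Fin n → ℤ) → ℂ) (ξ : Fin n → ℤ) : kerExt Φ 0 b (castZ ξ) = b ξ := by
  unfold kerExt
  rw [finsum_eq_single _ ξ]
  · simp [tensorKer, h0]
  · intro η hη
    obtain ⟨i, hi⟩ := Function.ne_iff.1 hη
    have : tensorKer Φ 0 (castZ ξ - castZ η) = 0 := by
      refine Finset.prod_eq_zero (Finset.mem_univ i) ?_
      have := h1 (ξ i - η i) (sub_ne_zero.2 (Ne.symm hi))
      simpa [castZ] using this
    simp [this]

lemma exists_abs_tensorKer_le {Φ : ℕ → ℝ → ℝ} {R : ℕ} (hΦ : ∀ j, ContDiff ℝ (⊤ : ℕ∞) (Φ j))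
    (hR : ∀ j x, (R : ℝ) ≤ |x| → Φ j x = 0) (γ : Fin n → ℕ) :
    ∃ B : ℝ, 0 < B ∧ ∀ ξ, |tensorKer Φ γ ξ| ≤ B := by
  have h : ∀ j, ∃ B : ℝ, ∀ x, ‖Φ j x‖ ≤ B := fun j =>
    (hΦ j).continuous.bounded_above_of_compact_support
      (HasCompactSupport.intro (isCompact_closedBall (0 : ℝ) R) fun x hx => hR j x (by
        simpa using (not_le.1 (fun h => hx (mem_closedBall_zero_iff.2 h))).le))
  choose B hB using h
  refine ⟨∏ i, max (B (γ i)) 1, Finset.prod_pos fun i _ => by positivity, fun ξ => ?_⟩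
  rw [tensorKer, Finset.abs_prod]
  exact Finset.prod_le_prod (fun i _ => abs_nonneg _) fun i _ => (hB _ _).trans (le_max_left _ _)

lemma contDiff_foldr_dd {σ : (Fin n → ℝ) → (Fin n → ℤ) → ℂ}
    (hσ : ∀ η, ContDiff ℝ (⊤ : ℕ∞) fun x => σ x η) (l : List (Fin n)) (η : Fin n → ℤ) :
    ContDiff ℝ (⊤ : ℕ∞) fun x => l.foldr dd (σ x) η := by
  induction l generalizing η with
  | nil => exact hσ η
  | cons j l ih => exact (ih _).sub (ih _)

lemma ContDiff.foldr_pd {f : (Fin n → ℝ) → ℂ} (hf : ContDiff ℝ (⊤ : ℕ∞) f)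
    (l : List (Fin n)) : ContDiff ℝ (⊤ : ℕ∞) (l.foldr pd f) := by
  induction l with
  | nil => exact hf
  | cons j l ih => exact ih.dirDeriv _

lemma foldr_pd_sum {ι : Type*} (s : Finset ι) (c : ι → ℂ) {F : ι → (Fin n → ℝ) → ℂ}
    (hF : ∀ i, ContDiff ℝ (⊤ : ℕ∞) (F i)) (l : List (Fin n)) :
    l.foldr pd (fun x => ∑ i ∈ s, c i * F i x) = fun x => ∑ i ∈ s, c i * l.foldr pd (F i) x := by
  induction l with
  | nil => rfl
  | cons j l ih =>
    rw [List.foldr_cons, ih]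
    funext x
    have h : ∀ i, HasFDerivAt (fun x => c i * l.foldr pd (F i) x)
        (c i • fderiv ℝ (l.foldr pd (F i)) x) x := fun i =>
      (((hF i).foldr_pd l).differentiable (by simp) x).hasFDerivAt.const_mul (c i)
    change fderiv ℝ (fun x => ∑ i ∈ s, c i * l.foldr pd (F i) x) x (Pi.single j 1) = _
    rw [(HasFDerivAt.fun_sum fun i _ => h i).fderiv, sum_apply]
    rfl

lemma symbDxDξ_kerExt {Φ : ℕ → ℝ → ℝ} {R N : ℕ} (hΦ : ∀ j, ContDiff ℝ (⊤ : ℕ∞) (Φ j))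
    (hR : ∀ j x, (R : ℝ) ≤ |x| → Φ j x = 0)
    (hder : ∀ j < N, ∀ x, HasDerivAt (Φ j) (Φ (j + 1) (x + 1) - Φ (j + 1) x) x)
    {σ : (Fin n → ℝ) → (Fin n → ℤ) → ℂ} (hσ : ∀ η, ContDiff ℝ (⊤ : ℕ∞) fun x => σ x η)
    (α β : Fin n → ℕ) (hα : ∑ j, α j ≤ N) (x ξ : Fin n → ℝ) :
    symbDxDξ β α (fun x ξ => kerExt Φ 0 (σ x) ξ) x ξ = ∑ η ∈ latticeBox (R + 2) ξ,
      (tensorKer Φ (fun i => (mIdxList α).count i) (ξ - castZ η) : ℂ) * symbDxD β α σ x η := by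
  have h : (fun x' => pdM α (fun ξ => kerExt Φ 0 (σ x') ξ) ξ) = fun x' =>
      ∑ η ∈ latticeBox (R + 2) ξ,
        (tensorKer Φ (fun i => (mIdxList α).count i) (ξ - castZ η) : ℂ) * ddM α (σ x') η := by
    funext x'
    change (mIdxList α).foldr pd (kerExt Φ 0 (σ x')) ξ = _
    rw [foldr_pd_kerExt hΦ hR hder _ _ (by rwa [mIdxList_length]),
      kerExt_eq_sum hR _ (ξ := ξ) (by simp)]
    rfl
  unfold symbDxDξ
  rw [h]
  exact congrFun (foldr_pd_sum _ _ (contDiff_foldr_dd hσ (mIdxList α)) (mIdxList β)) x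

lemma exists_symbDxDξ_kerExt_le {Φ : ℕ → ℝ → ℝ} {R N : ℕ}
    (hΦ : ∀ j, ContDiff ℝ (⊤ : ℕ∞) (Φ j)) (hR : ∀ j x, (R : ℝ) ≤ |x| → Φ j x = 0)
    (hder : ∀ j < N, ∀ x, HasDerivAt (Φ j) (Φ (j + 1) (x + 1) - Φ (j + 1) x) x)
    {σ : (Fin n → ℝ) → (Fin n → ℤ) → ℂ} (hσ : ∀ η, ContDiff ℝ (⊤ : ℕ∞) fun x => σ x η)
    (α β : Fin n → ℕ) (hα : ∑ j, α j ≤ N) (s : ℝ)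
    (h : ∃ C : ℝ, 0 < C ∧ ∀ (x : Fin n → ℝ) (ξ : Fin n → ℤ),
      ‖symbDxD β α σ x ξ‖ ≤ C * jb ξ ^ s) :
    ∃ C : ℝ, 0 < C ∧ ∀ x ξ : Fin n → ℝ,
      ‖symbDxDξ β α (fun x ξ => kerExt Φ 0 (σ x) ξ) x ξ‖ ≤ C * jbR ξ ^ s := by
  obtain ⟨C, hC0, hC⟩ := h
  obtain ⟨K, hK0, hK⟩ := exists_jbR_rpow_le n ((R + 2 : ℕ) + 1) s
  obtain ⟨B, hB0, hB⟩ := exists_abs_tensorKer_le hΦ hR fun i => (mIdxList α).count i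
  refine ⟨(2 * (R + 2) + 1 : ℕ) ^ n * (B * (C * K)), by positivity, fun x ξ => ?_⟩
  rw [symbDxDξ_kerExt hΦ hR hder hσ α β hα]
  have hterm : ∀ η ∈ latticeBox (R + 2) ξ,
      ‖(tensorKer Φ (fun i => (mIdxList α).count i) (ξ - castZ η) : ℂ) * symbDxD β α σ x η‖ ≤
        B * (C * (K * jbR ξ ^ s)) := by
    intro η hη
    rw [norm_mul, Complex.norm_real]
    refine mul_le_mul (hB _) ((hC x η).trans ?_) (norm_nonneg _) hB0.le
    exact mul_le_mul_of_nonneg_left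
      (hK (castZ η) ξ fun j => abs_sub_le_of_mem_latticeBox hη j) hC0.le
  refine (norm_sum_le_of_le _ hterm).trans_eq ?_
  rw [Finset.sum_const, card_latticeBox, nsmul_eq_mul]
  push_cast
  ring

end Extension

/-- **McLean's equivalence theorem with limited regularity.**
(i) The restriction to `𝕋ⁿ × ℤⁿ` of a smooth symbol on `𝕋ⁿ × ℝⁿ` satisfying the
`(ρ,δ)`-estimates `|∂_x^β ∂_ξ^α a| ≤ C_{α,β} ⟨ξ⟩^{m - ρ|α| + δ|β|}` for `|α| ≤ N₁`,
`|β| ≤ N₂` satisfies the corresponding difference estimates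
`|∂_x^β Δ_ξ^α ã| ≤ C′_{α,β} ⟨ξ⟩^{m - ρ|α| + δ|β|}`;
(ii) conversely, every toroidal symbol satisfying the difference estimates is the
restriction of a smooth symbol on `𝕋ⁿ × ℝⁿ` satisfying the `(ρ,δ)`-estimates. -/
theorem toroidal_euclidean_symbol_equivalence
    (n : ℕ) (hn : 1 ≤ n) (m δ ρ : ℝ) (hδ0 : 0 ≤ δ) (hδ1 : δ ≤ 1) (hρ0 : 0 < ρ)
    (hρ1 : ρ ≤ 1) (N₁ N₂ : ℕ) :
    (∀ a : (Fin n → ℝ) → (Fin n → ℝ) → ℂ,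
      (ContDiff ℝ (⊤ : ℕ∞) fun q : (Fin n → ℝ) × (Fin n → ℝ) => a q.1 q.2) →
      (∀ ξ, Per fun x => a x ξ) →
      (∀ α β : Fin n → ℕ, (∑ j, α j) ≤ N₁ → (∑ j, β j) ≤ N₂ →
        ∃ C : ℝ, 0 < C ∧ ∀ x ξ : Fin n → ℝ,
          ‖symbDxDξ β α a x ξ‖ ≤
            C * jbR ξ ^ (m - ρ * (∑ j, (α j : ℝ)) + δ * ∑ j, (β j : ℝ))) →
      ∀ α β : Fin n → ℕ, (∑ j, α j) ≤ N₁ → (∑ j, β j) ≤ N₂ →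
        ∃ C' : ℝ, 0 < C' ∧ ∀ (x : Fin n → ℝ) (ξ : Fin n → ℤ),
          ‖symbDxD β α (fun x' ξ' => a x' (castZ ξ')) x ξ‖ ≤
            C' * jb ξ ^ (m - ρ * (∑ j, (α j : ℝ)) + δ * ∑ j, (β j : ℝ)))
    ∧
    (∀ at' : (Fin n → ℝ) → (Fin n → ℤ) → ℂ,
      (∀ ξ, ContDiff ℝ (⊤ : ℕ∞) fun x => at' x ξ) →
      (∀ ξ, Per fun x => at' x ξ) →
      (∀ α β : Fin n → ℕ, (∑ j, α j) ≤ N₁ → (∑ j, β j) ≤ N₂ →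
        ∃ C : ℝ, 0 < C ∧ ∀ (x : Fin n → ℝ) (ξ : Fin n → ℤ),
          ‖symbDxD β α at' x ξ‖ ≤
            C * jb ξ ^ (m - ρ * (∑ j, (α j : ℝ)) + δ * ∑ j, (β j : ℝ))) →
      ∃ a : (Fin n → ℝ) → (Fin n → ℝ) → ℂ,
        (ContDiff ℝ (⊤ : ℕ∞) fun q : (Fin n → ℝ) × (Fin n → ℝ) => a q.1 q.2) ∧
        (∀ ξ, Per fun x => a x ξ) ∧
        (∀ (x : Fin n → ℝ) (ξ : Fin n → ℤ), a x (castZ ξ) = at' x ξ) ∧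
        (∀ α β : Fin n → ℕ, (∑ j, α j) ≤ N₁ → (∑ j, β j) ≤ N₂ →
          ∃ C' : ℝ, 0 < C' ∧ ∀ x ξ : Fin n → ℝ,
            ‖symbDxDξ β α a x ξ‖ ≤
              C' * jbR ξ ^ (m - ρ * (∑ j, (α j : ℝ)) + δ * ∑ j, (β j : ℝ)))) := by
  refine ⟨fun a ha _ h α β hα hβ => exists_symbDxD_castZ_le ha α β _ (h α β hα hβ),
    fun σ hσ hper h => ?_⟩
  obtain ⟨Φ, R, hΦ, hR, h0, h1, hder⟩ := exists_cardinal_kernels N₁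
  refine ⟨fun x ξ => kerExt Φ 0 (σ x) ξ, contDiff_kerExt hΦ hR 0 hσ, fun ξ x v => ?_,
    fun x ξ => kerExt_castZ h0 h1 _ ξ,
    fun α β hα hβ => exists_symbDxDξ_kerExt_le hΦ hR hder hσ α β hα _ (h α β hα hβ)⟩
  exact finsum_congr fun η => congrArg _ (hper η x v)
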